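/- arXiv:quant-ph/0606140 — 5 statements merged into one kernel-verified Lean document; each statement's English description precedes it below -/
import Mathlib

section
/- Let H be a real symmetric N×N matrix (N ≥ 1) all of whose off-diagonal entries are nonpositive. Then H admits a ground state with nonnegative amplitudes: there exists a nonzero vector v ∈ ℝ^N with v_i ≥ 0 for all i such that H·v = λ·v, where λ is the smallest eigenvalue of H. -/
open scoped Matrix

/-- A Hermitian matrix stays positive semidefinite after subtracting its smallest eigenvalue. -/
theorem Matrix.IsHermitian.posSemidef_sub_iInf_eigenvalues {n : Type*} [Fintype n] [DecidableEq n]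
    {A : Matrix n n ℝ} (hA : A.IsHermitian) :
    (A - algebraMap ℝ (Matrix n n ℝ) (⨅ i, hA.eigenvalues i)).PosSemidef := by
  refine Matrix.posSemidef_iff_isHermitian_and_spectrum_nonneg.mpr ⟨?_, ?_⟩
  · refine hA.sub ?_
    rw [Matrix.algebraMap_eq_diagonal]
    exact Matrix.isHermitian_diagonal _
  · rw [← spectrum.sub_singleton_eq, hA.spectrum_real_eq_range_eigenvalues]
    rintro _ ⟨_, ⟨i, rfl⟩, _, rfl, rfl⟩
    exact sub_nonneg.mpr (ciInf_le (Set.finite_range hA.eigenvalues).bddBelow i)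

/-- Taking absolute values of the amplitudes does not increase the quadratic form of a matrix with
nonpositive off-diagonal entries. -/
theorem Matrix.abs_dotProduct_mulVec_abs_le {n : Type*} [Fintype n] {A : Matrix n n ℝ}
    (hA : ∀ i j, i ≠ j → A i j ≤ 0) (v : n → ℝ) : |v| ⬝ᵥ A *ᵥ |v| ≤ v ⬝ᵥ A *ᵥ v := by
  simp only [dotProduct, mulVec, Finset.mul_sum, Pi.abs_apply]
  refine Finset.sum_le_sum fun i _ ↦ Finset.sum_le_sum fun j _ ↦ ?_
  obtain rfl | hij := eq_or_ne i j
  · exact le_of_eq (by linear_combination A i i * abs_mul_abs_self (v i))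
  · have h : v i * v j ≤ |v i| * |v j| := (le_abs_self _).trans (abs_mul _ _).le
    nlinarith [mul_le_mul_of_nonpos_left h (hA i j hij)]

/-- A real symmetric `N×N` matrix (`N ≥ 1`) with nonpositive off-diagonal
entries (a stoquastic matrix) has a ground state with nonnegative amplitudes: there is a
nonzero entrywise-nonnegative vector `v` with `H.mulVec v = λ • v`, where
`λ = ⨅ i, eigenvalues i` is the smallest eigenvalue of `H`. -/
theorem stoquastic_nonneg_ground_state (N : ℕ) (hN : 1 ≤ N)
    (H : Matrix (Fin N) (Fin N) ℝ) (hH : H.IsHermitian)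
    (hoff : ∀ i j : Fin N, i ≠ j → H i j ≤ 0) :
    ∃ v : Fin N → ℝ, v ≠ 0 ∧ (∀ i, 0 ≤ v i) ∧
      H.mulVec v = (⨅ i, hH.eigenvalues i) • v := by
  have : Nonempty (Fin N) := ⟨⟨0, hN⟩⟩
  obtain ⟨k, hk⟩ := exists_eq_ciInf_of_finite (f := hH.eigenvalues)
  have hM := hH.posSemidef_sub_iInf_eigenvalues
  have mulVec_sub (w : Fin N → ℝ) :
      (H - algebraMap ℝ (Matrix (Fin N) (Fin N) ℝ) (⨅ i, hH.eigenvalues i)) *ᵥ w =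
        H *ᵥ w - (⨅ i, hH.eigenvalues i) • w := by
    rw [Matrix.sub_mulVec, Algebra.algebraMap_eq_smul_one, Matrix.smul_mulVec, Matrix.one_mulVec]
  let v : Fin N → ℝ := ⇑(hH.eigenvectorBasis k)
  have hv : v ≠ 0 := fun h ↦ hH.eigenvectorBasis.toBasis.ne_zero k <| by
    ext i
    simpa using congrFun h i
  have hv_eig : H *ᵥ v = (⨅ i, hH.eigenvalues i) • v := hk ▸ hH.mulVec_eigenvectorBasis k
  refine ⟨|v|, by simpa using hv, fun i ↦ abs_nonneg (v i), ?_⟩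
  rw [← sub_eq_zero, ← mulVec_sub, ← hM.dotProduct_mulVec_zero_iff]
  refine le_antisymm ?_ (hM.dotProduct_mulVec_nonneg _)
  rw [star_trivial]
  refine (Matrix.abs_dotProduct_mulVec_abs_le (fun i j hij ↦ ?_) v).trans_eq ?_
  · simpa [Matrix.algebraMap_matrix_apply, hij] using hoff i j hij
  · rw [mulVec_sub, hv_eig, sub_self, dotProduct_zero]
end

section
/- Let 2 ≤ b ≤ k and let Ω ⊆ (𝔽₂)^k be a nonempty set with |Ω| ≤ 2^{b−2}. Let h₁, …, h_k be independent uniformly random b×k matrices over 𝔽₂, and let h(Ω) = ⋃_{j=1}^k h_j(Ω) ⊆ (𝔽₂)^b, where h_j(Ω) denotes the image of Ω under y ↦ h_j·y. Then Prob[ |h(Ω)| ≥ |Ω|/k ] ≥ 1 − 2^{−k}. -/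
open Finset in
/-- For `v ≠ 0`, the matrices killing `v` form a `|R| ^ |m|`-th part of all matrices. -/
theorem card_mulVec_eq_zero_mul {R m n : Type*} [Field R] [Fintype R] [DecidableEq R]
    [Fintype m] [DecidableEq m] [Fintype n] [DecidableEq n] {v : n → R} (hv : v ≠ 0) :
    #{A : Matrix m n R | A.mulVec v = 0} * Fintype.card R ^ Fintype.card m =
      Fintype.card (Matrix m n R) := by
  let f : Matrix m n R →+ (m → R) :=
    { toFun := fun A => A.mulVec v
      map_zero' := Matrix.zero_mulVec v
      map_add' := fun A B => Matrix.add_mulVec A B v }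
  have hf : Function.Surjective f := by
    intro w
    obtain ⟨i, hi⟩ := Function.ne_iff.1 hv
    refine ⟨Matrix.vecMulVec w (Pi.single i (v i)⁻¹), ?_⟩
    change (Matrix.vecMulVec w (Pi.single i (v i)⁻¹)).mulVec v = w
    rw [Matrix.vecMulVec_mulVec, single_dotProduct, inv_mul_cancel₀ hi]
    simp
  calc #{A : Matrix m n R | A.mulVec v = 0} * Fintype.card R ^ Fintype.card m
      = ∑ w : m → R, #{A : Matrix m n R | f A = w} := by
        rw [sum_congr rfl fun w _ =>
          AddMonoidHom.card_fiber_eq_of_mem_range f (hf w) (hf 0), sum_const, card_univ,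
          Fintype.card_fun, smul_eq_mul, mul_comm]
        rfl
    _ = Fintype.card (Matrix m n R) :=
        (card_eq_sum_card_fiberwise fun A _ => mem_univ (f A)).symm

/-- The linear hash functions under which some other element of `Ω` collides with `y`. -/
def collidingMatrices {R m n : Type*} [Field R] [Fintype R] [DecidableEq R]
    [Fintype m] [DecidableEq m] [Fintype n] [DecidableEq n] (Ω : Finset (n → R)) (y : n → R) :
    Finset (Matrix m n R) :=
  {A | ∃ z ∈ Ω.erase y, A.mulVec z = A.mulVec y}

section LinearHashing

variable {R m n : Type*} [Field R] [Fintype R] [DecidableEq R]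
  [Fintype m] [DecidableEq m] [Fintype n] [DecidableEq n]

open Finset

theorem card_collidingMatrices_mul_le (Ω : Finset (n → R)) (y : n → R) :
    #(collidingMatrices Ω y : Finset (Matrix m n R)) * Fintype.card R ^ Fintype.card m ≤
      #Ω * Fintype.card (Matrix m n R) := by
  have hsub : (collidingMatrices Ω y : Finset (Matrix m n R)) ⊆
      (Ω.erase y).biUnion fun z => {A : Matrix m n R | A.mulVec (z - y) = 0} := by
    intro A
    simp [collidingMatrices, Matrix.mulVec_sub, sub_eq_zero]
  calc #(collidingMatrices Ω y : Finset (Matrix m n R)) * Fintype.card R ^ Fintype.card m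
      ≤ (∑ z ∈ Ω.erase y, #{A : Matrix m n R | A.mulVec (z - y) = 0}) *
          Fintype.card R ^ Fintype.card m :=
        Nat.mul_le_mul_right _ ((card_le_card hsub).trans card_biUnion_le)
    _ = #(Ω.erase y) * Fintype.card (Matrix m n R) := by
        rw [sum_mul, sum_congr rfl fun z hz =>
          card_mulVec_eq_zero_mul (sub_ne_zero.2 (ne_of_mem_erase hz)), sum_const, smul_eq_mul]
    _ ≤ #Ω * Fintype.card (Matrix m n R) :=
        Nat.mul_le_mul_right _ (card_le_card (erase_subset _ _))

/-- If every element of `Ω` is isolated by one of the hash functions, then the union of the images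
has at least `|Ω| / |ι|` elements. -/
theorem card_le_mul_card_biUnion_image {ι : Type*} [Fintype ι] (Ω : Finset (n → R))
    (H : ι → Matrix m n R) (hH : ∀ y ∈ Ω, ∃ j, H j ∉ collidingMatrices Ω y) :
    #Ω ≤ Fintype.card ι * #(univ.biUnion fun j => Ω.image fun y => (H j).mulVec y) := by
  have hsub : Ω ⊆ univ.biUnion fun j => {y ∈ Ω | H j ∉ collidingMatrices Ω y} := by
    intro y hy
    simpa [hy] using hH y hy
  refine (card_le_card hsub).trans (card_biUnion_le_card_mul _ _ _ fun j _ => ?_)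
  refine card_le_card_of_injOn (fun y => (H j).mulVec y) ?_ ?_
  · intro y hy
    exact mem_biUnion.2 ⟨j, mem_univ j, mem_image_of_mem _ (mem_filter.1 hy).1⟩
  · intro y hy z hz hyz
    by_contra hne
    refine (mem_filter.1 hz).2 ?_
    simp only [collidingMatrices, mem_filter, mem_univ, true_and]
    exact ⟨y, mem_erase.2 ⟨hne, (mem_filter.1 hy).1⟩, hyz⟩

end LinearHashing


/-- Goldwasser–Sipser hashing lemma, Lemma A.1 of the paper. Let
`2 ≤ b ≤ k` and let `Ω ⊆ (𝔽₂)^k` be nonempty with `|Ω| ≤ 2^{b−2}`. For `k` independent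
uniformly random `b×k` matrices `H 1, …, H k` over `𝔽₂` (formalized by counting over all
tuples), the image `h(Ω) = ⋃_j (H j)(Ω) ⊆ (𝔽₂)^b` satisfies `|h(Ω)| ≥ |Ω|/k` with
probability at least `1 − 2^{−k}`. -/
theorem goldwasser_sipser_hashing (k b : ℕ) (hb2 : 2 ≤ b) (hbk : b ≤ k)
    (Ω : Finset (Fin k → ZMod 2)) (hΩne : Ω.Nonempty) (hΩcard : Ω.card ≤ 2 ^ (b - 2)) :
    (1 : ℝ) - (2 ^ k : ℝ)⁻¹ ≤
      (Nat.card {H : Fin k → Matrix (Fin b) (Fin k) (ZMod 2) //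
          (Ω.card : ℝ) / (k : ℝ) ≤
            ((Finset.univ.biUnion fun j : Fin k =>
              Ω.image fun y => (H j).mulVec y).card : ℝ)} : ℝ) /
        (Nat.card (Fin k → Matrix (Fin b) (Fin k) (ZMod 2)) : ℝ) := by
  classical
  have hk : 0 < k := by lia
  let M := Matrix (Fin b) (Fin k) (ZMod 2)
  let good : Finset (Fin k → M) := {H | (Ω.card : ℝ) / (k : ℝ) ≤
    ((Finset.univ.biUnion fun j : Fin k => Ω.image fun y => (H j).mulVec y).card : ℝ)}
  have hcoll (y : Fin k → ZMod 2) :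
      (collidingMatrices Ω y : Finset M).card * 4 ≤ Fintype.card M := by
    have h := card_collidingMatrices_mul_le (m := Fin b) Ω y
    obtain ⟨c, rfl⟩ := Nat.exists_eq_add_of_le' hb2
    rw [ZMod.card, Fintype.card_fin, pow_add] at h
    refine Nat.le_of_mul_le_mul_left ?_ (pow_pos two_pos c)
    calc 2 ^ c * ((collidingMatrices Ω y : Finset M).card * 4)
        = (collidingMatrices Ω y : Finset M).card * (2 ^ c * 2 ^ 2) := by ring
      _ ≤ Ω.card * Fintype.card M := h
      _ ≤ 2 ^ c * Fintype.card M := Nat.mul_le_mul_right _ hΩcard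
  have hsub : goodᶜ ⊆ Ω.biUnion fun y =>
      Fintype.piFinset fun _ : Fin k => (collidingMatrices Ω y : Finset M) := by
    intro H hH
    by_contra hcon
    simp only [Finset.mem_biUnion, Fintype.mem_piFinset, not_exists, not_and, not_forall] at hcon
    refine Finset.mem_compl.1 hH (Finset.mem_filter.2 ⟨Finset.mem_univ H, ?_⟩)
    rw [div_le_iff₀' (by exact_mod_cast hk)]
    have h := card_le_mul_card_biUnion_image Ω H hcon
    rw [Fintype.card_fin] at h
    exact_mod_cast h
  have hbad : goodᶜ.card * 2 ^ k ≤ Fintype.card (Fin k → M) := by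
    refine Nat.le_of_mul_le_mul_left ?_ (pow_pos two_pos k)
    calc 2 ^ k * (goodᶜ.card * 2 ^ k) = goodᶜ.card * 4 ^ k := by
          rw [show 4 = 2 * 2 from rfl, mul_pow]; ring
      _ ≤ (∑ y ∈ Ω, (collidingMatrices Ω y : Finset M).card ^ k) * 4 ^ k := by
          refine Nat.mul_le_mul_right _ ((Finset.card_le_card hsub).trans ?_)
          simpa [Fintype.card_piFinset] using Finset.card_biUnion_le (s := Ω) (t := fun y =>
            Fintype.piFinset fun _ : Fin k => (collidingMatrices Ω y : Finset M))
      _ ≤ Ω.card * Fintype.card M ^ k := by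
          rw [Finset.sum_mul, ← smul_eq_mul]
          refine Finset.sum_le_card_nsmul _ _ _ fun y _ => ?_
          rw [← mul_pow]
          exact Nat.pow_le_pow_left (hcoll y) k
      _ ≤ 2 ^ k * Fintype.card (Fin k → M) := by
          rw [Fintype.card_fun, Fintype.card_fin]
          exact Nat.mul_le_mul_right _
            (hΩcard.trans (Nat.pow_le_pow_right two_pos (by lia)))
  have hgood : good.card + goodᶜ.card = Fintype.card (Fin k → M) := Finset.card_add_card_compl good
  have hpos : (0 : ℝ) < Fintype.card (Fin k → M) := by exact_mod_cast Fintype.card_pos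
  rw [Nat.card_eq_fintype_card, Nat.card_eq_fintype_card, Fintype.card_subtype]
  change _ ≤ (good.card : ℝ) / (Fintype.card (Fin k → M) : ℝ)
  have hbad' : (goodᶜ.card : ℝ) ≤ Fintype.card (Fin k → M) * (2 ^ k : ℝ)⁻¹ := by
    rw [← div_eq_mul_inv, le_div_iff₀ (by positivity)]
    exact_mod_cast hbad
  have hgood' : (good.card : ℝ) + goodᶜ.card = Fintype.card (Fin k → M) := by exact_mod_cast hgood
  rw [le_div_iff₀ hpos]
  linarith
end

section
/- Let X = [[0,1],[1,0]] and Z = [[1,0],[0,−1]] be the real Pauli matrices, let Δ_x, Δ_z be real numbers, and define the 8×8 real matrix H_M = −(Δ_x/2)·(X⊗X⊗X − I) − (Δ_z/4)·(Z⊗Z⊗I + I⊗Z⊗Z + Z⊗I⊗Z − 3·I) on (ℂ²)^{⊗3} (equivalently ℝ^8). Define Ψ⁺ = (|000⟩ + |111⟩)/√2, Ψ⁻ = (|000⟩ − |111⟩)/√2, and φ_j^± = X_j Ψ^± for j = 1,2,3, where X_j applies X to the j-th tensor factor. Then these eight vectors form an orthonormal basis of eigenvectors of H_M, with H_M Ψ⁺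 = 0, H_M Ψ⁻ = Δ_x·Ψ⁻, H_M φ_j^+ = Δ_z·φ_j^+, and H_M φ_j^- = (Δ_z + Δ_x)·φ_j^-. -/
open Matrix Kronecker

namespace ThreeQubitGadget

/-- The three-qubit index set `(ℂ²)^{⊗3}` (here over `ℝ`, since all data is real). -/
abbrev Q3 := (Fin 2 × Fin 2) × Fin 2

/-- The real Pauli matrix `X = [[0,1],[1,0]]`. -/
def X : Matrix (Fin 2) (Fin 2) ℝ := !![0, 1; 1, 0]

/-- The real Pauli matrix `Z = [[1,0],[0,−1]]`. -/
def Z : Matrix (Fin 2) (Fin 2) ℝ := !![1, 0; 0, -1]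

/-- The mediator Hamiltonian
`H_M = −(Δ_x/2)(X⊗X⊗X − I) − (Δ_z/4)(Z⊗Z⊗I + I⊗Z⊗Z + Z⊗I⊗Z − 3I)`. -/
noncomputable def HM (Δx Δz : ℝ) : Matrix Q3 Q3 ℝ :=
  -(Δx / 2) • (X ⊗ₖ X ⊗ₖ X - 1) -
    (Δz / 4) • (Z ⊗ₖ Z ⊗ₖ (1 : Matrix (Fin 2) (Fin 2) ℝ)
      + (1 : Matrix (Fin 2) (Fin 2) ℝ) ⊗ₖ Z ⊗ₖ Z
      + Z ⊗ₖ (1 : Matrix (Fin 2) (Fin 2) ℝ) ⊗ₖ Z - (3 : ℝ) • 1)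

/-- The standard basis vector `|abc⟩` of `(ℂ²)^{⊗3} ≅ ℝ^8`. -/
def ket (a b c : Fin 2) : Q3 → ℝ := fun p => if p = ((a, b), c) then 1 else 0

/-- `Ψ⁺ = (|000⟩ + |111⟩)/√2` (for `s = true`) and `Ψ⁻ = (|000⟩ − |111⟩)/√2`
(for `s = false`). -/
noncomputable def psi (s : Bool) : Q3 → ℝ :=
  (Real.sqrt 2)⁻¹ • (ket 0 0 0 + (if s then (1 : ℝ) else -1) • ket 1 1 1)

/-- `X_j`: the Pauli `X` applied to the `j`-th tensor factor. -/
def Xj (j : Fin 3) : Matrix Q3 Q3 ℝ :=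
  ![X ⊗ₖ (1 : Matrix (Fin 2) (Fin 2) ℝ) ⊗ₖ (1 : Matrix (Fin 2) (Fin 2) ℝ),
    (1 : Matrix (Fin 2) (Fin 2) ℝ) ⊗ₖ X ⊗ₖ (1 : Matrix (Fin 2) (Fin 2) ℝ),
    (1 : Matrix (Fin 2) (Fin 2) ℝ) ⊗ₖ (1 : Matrix (Fin 2) (Fin 2) ℝ) ⊗ₖ X] j

/-- `φ_j^± = X_j Ψ^±`. -/
noncomputable def phi (j : Fin 3) (s : Bool) : Q3 → ℝ := (Xj j).mulVec (psi s)

/-- The family of the eight vectors `Ψ^±, φ_1^±, φ_2^±, φ_3^±`, indexed by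
`Option (Fin 3) × Bool` (with `none ↦ Ψ^±` and `some j ↦ φ_j^±`). -/
noncomputable def vfam : Option (Fin 3) × Bool → Q3 → ℝ := fun p =>
  match p.1 with
  | none => psi p.2
  | some j => phi j p.2

lemma phi_apply (j : Fin 3) (s : Bool) (a b c : Fin 2) :
    phi j s ((a, b), c) =
      psi s (![((a + 1, b), c), ((a, b + 1), c), ((a, b), c + 1)] j) := by
  fin_cases j <;> fin_cases a <;> fin_cases b <;> fin_cases c <;>
    simp [phi, Xj, mulVec, dotProduct, Fintype.sum_prod_type, X, Matrix.one_apply]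

lemma vfam_dotProduct (u v : Option (Fin 3) × Bool) :
    vfam u ⬝ᵥ vfam v = if u = v then 1 else 0 := by
  have h : (Real.sqrt 2)⁻¹ * (Real.sqrt 2)⁻¹ = 1 / 2 := by
    rw [← mul_inv, Real.mul_self_sqrt (by norm_num)]; norm_num
  obtain ⟨_ | j, s⟩ := u <;> obtain ⟨_ | k, t⟩ := v <;> cases s <;> cases t <;>
    (try fin_cases j) <;> (try fin_cases k) <;>
    simp [vfam, dotProduct, Fintype.sum_prod_type, phi_apply, psi, ket, h] <;>
    norm_num

lemma linearIndependent_vfam : LinearIndependent ℝ vfam := by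
  rw [Fintype.linearIndependent_iff]
  intro g hg u
  have h := congrArg (fun w => vfam u ⬝ᵥ w) hg
  simpa [dotProduct_sum, dotProduct_smul, vfam_dotProduct] using h

lemma span_range_vfam : Submodule.span ℝ (Set.range vfam) = ⊤ :=
  linearIndependent_vfam.span_eq_top_of_card_eq_finrank (by simp [Q3])

lemma HM_mulVec_apply (Δx Δz : ℝ) (w : Q3 → ℝ) (a b c : Fin 2) :
    (HM Δx Δz).mulVec w ((a, b), c) =
      Δx / 2 * (w ((a, b), c) - w ((a + 1, b + 1), c + 1)) +
        (if a = b ∧ b = c then 0 else Δz) * w ((a, b), c) := by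
  fin_cases a <;> fin_cases b <;> fin_cases c <;>
    simp [HM, mulVec, dotProduct, Fintype.sum_prod_type, X, Z, Matrix.one_apply] <;> ring

/-- The eight vectors `Ψ^±`, `φ_j^±` form an orthonormal basis of
eigenvectors of `H_M`, with `H_M Ψ⁺ = 0`, `H_M Ψ⁻ = Δ_x Ψ⁻`, `H_M φ_j^+ = Δ_z φ_j^+`,
and `H_M φ_j^- = (Δ_z + Δ_x) φ_j^-`. -/
theorem three_qubit_gadget_spectrum (Δx Δz : ℝ) :
    (∀ u v : Option (Fin 3) × Bool, vfam u ⬝ᵥ vfam v = if u = v then 1 else 0) ∧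
    Submodule.span ℝ (Set.range vfam) = ⊤ ∧
    (HM Δx Δz).mulVec (psi true) = 0 ∧
    (HM Δx Δz).mulVec (psi false) = Δx • psi false ∧
    (∀ j : Fin 3, (HM Δx Δz).mulVec (phi j true) = Δz • phi j true) ∧
    (∀ j : Fin 3, (HM Δx Δz).mulVec (phi j false) = (Δz + Δx) • phi j false) := by
  refine ⟨vfam_dotProduct, span_range_vfam, ?_, ?_, fun j => ?_, fun j => ?_⟩ <;>
    ext ⟨⟨a, b⟩, c⟩ <;> (try fin_cases j) <;>
    fin_cases a <;> fin_cases b <;> fin_cases c <;>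
    simp [HM_mulVec_apply, phi_apply, psi, ket] <;> ring

end ThreeQubitGadget
end

section
/- Let H be a real symmetric N×N matrix with nonpositive off-diagonal entries such that every row of H contains at most s ≥ 1 nonzero entries and every entry satisfies |H_{xy}| ≤ J for some J > 0. Let q = 2·s·J and G = (1/2)·(I − H/q). Then: (i) all entries of G are nonnegative; (ii) every row sum of G lies in the interval [1/4, 3/4] (in particular G is doubly-substochastic); (iii) every eigenvalue of G lies in [1/4, 3/4] ⊆ [0,1]; and (iv) the largest eigenvalue of G equals (1/2)·(1 − λ(H)/q), where λ(H) is the smallest eigenvalue of H. -/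
open Matrix

/-- A row with at most `s` nonzero entries, each bounded by `J`, has `ℓ¹` norm at most `s * J`. -/
lemma sum_abs_le_of_ncard_support_le {ι : Type*} [Fintype ι] {f : ι → ℝ} {s : ℕ} {J : ℝ}
    (hJ : 0 ≤ J) (hs : {i | f i ≠ 0}.ncard ≤ s) (hf : ∀ i, |f i| ≤ J) :
    ∑ i, |f i| ≤ s * J := by
  classical
  have hcard : (Finset.univ.filter fun i => f i ≠ 0).card ≤ s := by
    rwa [← Set.ncard_coe_finset, Finset.coe_filter_univ]
  calc ∑ i, |f i| = ∑ i with f i ≠ 0, |f i| := by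
        refine (Finset.sum_filter_of_ne fun i _ h => ?_).symm
        exact abs_ne_zero.mp h
    _ ≤ (Finset.univ.filter fun i => f i ≠ 0).card • J :=
        Finset.sum_le_card_nsmul _ _ _ fun i _ => hf i
    _ ≤ s * J := by
        rw [nsmul_eq_mul]
        gcongr

/-- Every real eigenvalue of a matrix is bounded by the maximal `ℓ¹` norm of its rows. -/
lemma abs_le_of_mulVec_eq_smul {ι : Type*} [Fintype ι] {A : Matrix ι ι ℝ} {B : ℝ}
    (hA : ∀ i, ∑ j, |A i j| ≤ B) {ν : ℝ} {v : ι → ℝ} (hv : v ≠ 0)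
    (h : A.mulVec v = ν • v) : |ν| ≤ B := by
  obtain ⟨k, hk⟩ := Function.ne_iff.mp hv
  have : Nonempty ι := ⟨k⟩
  obtain ⟨i, hi⟩ := Finite.exists_max fun i => |v i|
  have hpos : 0 < |v i| := (abs_pos.mpr hk).trans_le (hi k)
  refine le_of_mul_le_mul_right ?_ hpos
  calc |ν| * |v i| = |∑ j, A i j * v j| := by
        rw [← abs_mul, ← smul_eq_mul, ← Pi.smul_apply, ← h]
        rfl
    _ ≤ ∑ j, |A i j| * |v j| := by
        simpa only [abs_mul] using Finset.abs_sum_le_sum_abs (fun j => A i j * v j) Finset.univ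
    _ ≤ ∑ j, |A i j| * |v i| := by
        exact Finset.sum_le_sum fun j _ => mul_le_mul_of_nonneg_left (hi j) (abs_nonneg _)
    _ = (∑ j, |A i j|) * |v i| := (Finset.sum_mul ..).symm
    _ ≤ B * |v i| := by
        gcongr
        exact hA i

/-- The real numbers admitting an eigenvector of a Hermitian real matrix are exactly its
`eigenvalues`. -/
lemma Matrix.IsHermitian.exists_mulVec_eq_smul_iff {ι : Type*} [Fintype ι] [DecidableEq ι]
    {A : Matrix ι ι ℝ} (hA : A.IsHermitian) {ν : ℝ} :
    (∃ v : ι → ℝ, v ≠ 0 ∧ A.mulVec v = ν • v) ↔ ∃ i, hA.eigenvalues i = ν := by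
  rw [← Set.mem_range, ← hA.spectrum_real_eq_range_eigenvalues, ← Matrix.spectrum_toLin',
    ← Module.End.hasEigenvalue_iff_mem_spectrum]
  constructor
  · rintro ⟨v, hv, h⟩
    exact Module.End.hasEigenvalue_of_hasEigenvector (x := v)
      ⟨Module.End.mem_eigenspace_iff.mpr h, hv⟩
  · intro h
    obtain ⟨v, hv⟩ := h.exists_hasEigenvector
    exact ⟨v, hv.2, hv.apply_eq_smul⟩

/-- `½(1 - H/q)` and `H` have the same eigenvectors. -/
lemma half_smul_one_sub_mulVec_eq_smul_iff {ι : Type*} [Fintype ι] [DecidableEq ι]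
    {H : Matrix ι ι ℝ} {q : ℝ} (hq : q ≠ 0) {μ : ℝ} {v : ι → ℝ} :
    ((1 / 2 : ℝ) • (1 - q⁻¹ • H)).mulVec v = μ • v ↔
      H.mulVec v = (q * (1 - 2 * μ)) • v := by
  simp only [smul_mulVec, sub_mulVec, one_mulVec, funext_iff, Pi.smul_apply, Pi.sub_apply,
    smul_eq_mul]
  refine forall_congr' fun i => ?_
  field_simp
  constructor <;> intro h <;> linarith

/-- Eqs. (12)–(13) of the paper. For a sparse stoquastic matrix `H`
(symmetric, nonpositive off-diagonal, at most `s` nonzero entries per row, entries bounded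
by `J`), setting `q = 2sJ` and `G = ½(I − H/q)`: (i) `G` has nonnegative entries; (ii) all
row sums of `G` lie in `[1/4, 3/4]` (so `G` is doubly-substochastic); (iii) every
eigenvalue of `G` lies in `[1/4, 3/4]`; (iv) the largest eigenvalue of `G` equals
`½(1 − λ(H)/q)` where `λ(H)` is the smallest eigenvalue of `H`. -/
theorem stoquastic_to_substochastic (N s : ℕ) (hN : 1 ≤ N) (hs : 1 ≤ s)
    (J : ℝ) (hJ : 0 < J)
    (H : Matrix (Fin N) (Fin N) ℝ) (hH : H.IsHermitian)
    (hoff : ∀ x y : Fin N, x ≠ y → H x y ≤ 0)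
    (hsparse : ∀ x : Fin N, {y : Fin N | H x y ≠ 0}.ncard ≤ s)
    (hbound : ∀ x y : Fin N, |H x y| ≤ J)
    (q : ℝ) (hq : q = 2 * (s : ℝ) * J)
    (G : Matrix (Fin N) (Fin N) ℝ) (hG : G = (1 / 2 : ℝ) • (1 - q⁻¹ • H)) :
    (∀ x y : Fin N, 0 ≤ G x y) ∧
    (∀ x : Fin N, 1 / 4 ≤ ∑ y, G x y ∧ ∑ y, G x y ≤ 3 / 4) ∧
    (∀ (μ : ℝ) (v : Fin N → ℝ), v ≠ 0 → G.mulVec v = μ • v →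
        1 / 4 ≤ μ ∧ μ ≤ 3 / 4) ∧
    IsGreatest {μ : ℝ | ∃ v : Fin N → ℝ, v ≠ 0 ∧ G.mulVec v = μ • v}
      ((1 / 2) * (1 - (⨅ i, hH.eigenvalues i) / q)) := by
  have hs' : (1 : ℝ) ≤ s := by exact_mod_cast hs
  have hJq : 2 * J ≤ q := by rw [hq]; nlinarith
  have hqpos : 0 < q := by linarith
  have hrow : ∀ x, ∑ y, |H x y| ≤ q / 2 := fun x =>
    (sum_abs_le_of_ncard_support_le hJ.le (hsparse x) (hbound x)).trans_eq (by rw [hq]; ring)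
  subst hG
  refine ⟨fun x y => ?_, fun x => ?_, fun μ v hv h => ?_, ?_, ?_⟩
  · rcases eq_or_ne x y with rfl | hxy
    · have : q⁻¹ * H x x ≤ 1 := by
        rw [inv_mul_le_iff₀ hqpos]
        linarith [le_of_abs_le (hbound x x)]
      simpa using this
    · have : 2⁻¹ * (q⁻¹ * H x y) ≤ 0 :=
        mul_nonpos_of_nonneg_of_nonpos (by norm_num)
          (mul_nonpos_of_nonneg_of_nonpos (inv_nonneg.mpr hqpos.le) (hoff x y hxy))
      simpa [hxy] using this
  · have hsum : ∑ y, ((1 / 2 : ℝ) • (1 - q⁻¹ • H)) x y = 1 / 2 * (1 - (∑ y, H x y) / q) := by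
      simp [← Finset.mul_sum, Matrix.one_apply, div_eq_inv_mul]
    obtain ⟨hl, hu⟩ := abs_le.mp ((Finset.abs_sum_le_sum_abs (H x) Finset.univ).trans (hrow x))
    have hl' : -(1 / 2) ≤ (∑ y, H x y) / q := by rw [le_div_iff₀ hqpos]; linarith
    have hu' : (∑ y, H x y) / q ≤ 1 / 2 := by rw [div_le_iff₀ hqpos]; linarith
    rw [hsum]
    constructor <;> linarith
  · rw [half_smul_one_sub_mulVec_eq_smul_iff hqpos.ne'] at h
    obtain ⟨hl, hu⟩ := abs_le.mp (abs_le_of_mulVec_eq_smul hrow hv h)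
    constructor <;> nlinarith
  · have : Nonempty (Fin N) := ⟨⟨0, hN⟩⟩
    obtain ⟨i, hi⟩ := exists_eq_ciInf_of_finite (f := hH.eigenvalues)
    obtain ⟨v, hv, h⟩ := hH.exists_mulVec_eq_smul_iff.mpr ⟨i, hi⟩
    refine ⟨v, hv, (half_smul_one_sub_mulVec_eq_smul_iff hqpos.ne').mpr ?_⟩
    rw [h]
    congr 1
    field_simp
    ring
  · rintro μ ⟨v, hv, h⟩
    rw [half_smul_one_sub_mulVec_eq_smul_iff hqpos.ne'] at h
    obtain ⟨i, hi⟩ := hH.exists_mulVec_eq_smul_iff.mp ⟨v, hv, h⟩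
    have hle : (⨅ i, hH.eigenvalues i) / q ≤ 1 - 2 * μ := by
      rw [div_le_iff₀' hqpos, ← hi]
      exact ciInf_le (Set.finite_range _).bddBelow i
    linarith
end

section
/- Let n ≥ 1 and N = 2^n. Let G be a real symmetric N×N matrix with nonnegative entries, μ₀ its largest eigenvalue with 0 < μ₀ ≤ 1, and Ψ₀ an entrywise-nonnegative unit vector with G·Ψ₀ = μ₀·Ψ₀. Suppose every eigenvalue of G lies in [0, μ₀], and that all eigenvalues of G on the orthogonal complement of Ψ₀ are at most μ₁, where μ₁ satisfies (μ₁/μ₀)^L ≤ 2^{−5n/2} for a given integer L ≥ 1 (this holds e.g. when log₂ μ₀ − log₂ μ₁ ≥ 1/r and L ≥ 5nr/2). Then Σ_{x,y} (G^L)_{xy} > 0 and | Σ_{x,y}(G^{L+1})_{xy} / Σ_{x,y}(G^L)_{xy} − μ₀ | ≤ 4·2^{−3n/2}. -/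
open Matrix

section SpectralGap

variable {ι : Type*} [Fintype ι]

theorem one_le_sum_of_sum_sq_eq_one {ψ : ι → ℝ} (hψ : ∀ i, 0 ≤ ψ i) (h : ∑ i, ψ i ^ 2 = 1) :
    1 ≤ ∑ i, ψ i := by
  have hle := Finset.sum_sq_le_sq_sum_of_nonneg (s := Finset.univ) fun i _ => hψ i
  rw [h] at hle
  exact (one_le_sq_iff₀ (Finset.sum_nonneg fun i _ => hψ i)).1 hle

theorem Matrix.IsSymm.mulVec_dotProduct {A : Matrix ι ι ℝ} (hA : A.IsSymm) (v w : ι → ℝ) :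
    A *ᵥ v ⬝ᵥ w = v ⬝ᵥ A *ᵥ w := by
  rw [dotProduct_mulVec, ← mulVec_transpose, hA.eq]

/-- A real positive semidefinite form that is bounded by `μ` at `v` and at `A v` satisfies
`‖A v‖² ≤ μ ⟨v, A v⟩`. -/
theorem Matrix.PosSemidef.mulVec_dotProduct_mulVec_le {A : Matrix ι ι ℝ} (hA : A.PosSemidef)
    {μ : ℝ} (hμ : 0 ≤ μ) (v : ι → ℝ) (hv : v ⬝ᵥ A *ᵥ v ≤ μ * (v ⬝ᵥ v))
    (hAv : A *ᵥ v ⬝ᵥ A *ᵥ (A *ᵥ v) ≤ μ * (A *ᵥ v ⬝ᵥ A *ᵥ v)) :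
    A *ᵥ v ⬝ᵥ A *ᵥ v ≤ μ * (v ⬝ᵥ A *ᵥ v) := by
  have hsymm : A.IsSymm := by simpa [IsHermitian, IsSymm] using hA.isHermitian
  rcases hμ.eq_or_lt with rfl | hpos
  · have h0 : v ⬝ᵥ A *ᵥ v = 0 :=
      le_antisymm (by simpa using hv) (by simpa using hA.dotProduct_mulVec_nonneg v)
    have hz : A *ᵥ v = 0 := (hA.dotProduct_mulVec_zero_iff v).1 (by simpa using h0)
    simp [hz]
  · have h := hA.dotProduct_mulVec_nonneg (μ • v - A *ᵥ v)
    simp only [star_trivial, mulVec_sub, mulVec_smul, sub_dotProduct, dotProduct_sub,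
      smul_dotProduct, dotProduct_smul, smul_eq_mul, ← hsymm.mulVec_dotProduct v (A *ᵥ v)] at h
    refine le_of_mul_le_mul_left ?_ hpos
    linarith

variable [DecidableEq ι]

theorem Matrix.IsSymm.posSemidef_of_eigenvalue_nonneg {A : Matrix ι ι ℝ} (hA : A.IsSymm)
    (h : ∀ (μ : ℝ) (v : ι → ℝ), v ≠ 0 → A *ᵥ v = μ • v → 0 ≤ μ) : A.PosSemidef := by
  have hH : A.IsHermitian := by simpa [IsHermitian, IsSymm] using hA
  refine hH.posSemidef_iff_eigenvalues_nonneg.2 fun i => ?_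
  refine h _ _ ?_ (hH.mulVec_eigenvectorBasis i)
  intro h0
  exact hH.eigenvectorBasis.orthonormal.ne_zero i (by ext j; exact congrFun h0 j)

/-- If a quadratic form is bounded by `μ` on the orthogonal complement of an eigenvector, then
the moments `⟨w, A ^ m w⟩` of a vector `w` in this complement grow at most by factors `μ`. -/
theorem Matrix.PosSemidef.dotProduct_pow_succ_mulVec_le {A : Matrix ι ι ℝ} (hA : A.PosSemidef)
    {ψ : ι → ℝ} {lam μ : ℝ} (hψ : A *ᵥ ψ = lam • ψ) (hμ : 0 ≤ μ)
    (hperp : ∀ w : ι → ℝ, w ⬝ᵥ ψ = 0 → w ⬝ᵥ A *ᵥ w ≤ μ * (w ⬝ᵥ w)) (m : ℕ) {w : ι → ℝ}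
    (hw : w ⬝ᵥ ψ = 0) : w ⬝ᵥ A ^ (m + 1) *ᵥ w ≤ μ * (w ⬝ᵥ A ^ m *ᵥ w) := by
  have hsymm : A.IsSymm := by simpa [IsHermitian, IsSymm] using hA.isHermitian
  have hstep {w : ι → ℝ} (hw : w ⬝ᵥ ψ = 0) : A *ᵥ w ⬝ᵥ ψ = 0 := by
    rw [hsymm.mulVec_dotProduct, hψ, dotProduct_smul, hw, smul_zero]
  have hshift (k : ℕ) (w : ι → ℝ) :
      w ⬝ᵥ A ^ (k + 2) *ᵥ w = A *ᵥ w ⬝ᵥ A ^ k *ᵥ (A *ᵥ w) := by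
    rw [hsymm.mulVec_dotProduct, mulVec_mulVec, mulVec_mulVec, ← pow_succ', ← pow_succ]
  induction m using Nat.twoStepInduction generalizing w with
  | zero => simpa using hperp w hw
  | one =>
    rw [hshift 0, pow_zero, one_mulVec, pow_one]
    exact hA.mulVec_dotProduct_mulVec_le hμ w (hperp w hw) (hperp _ (hstep hw))
  | more k ih _ =>
    rw [hshift (k + 1), hshift k]
    exact ih (hstep hw)

theorem Matrix.PosSemidef.dotProduct_pow_mulVec_le {A : Matrix ι ι ℝ} (hA : A.PosSemidef)
    {ψ : ι → ℝ} {lam μ : ℝ} (hψ : A *ᵥ ψ = lam • ψ) (hμ : 0 ≤ μ)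
    (hperp : ∀ w : ι → ℝ, w ⬝ᵥ ψ = 0 → w ⬝ᵥ A *ᵥ w ≤ μ * (w ⬝ᵥ w)) (m : ℕ) {w : ι → ℝ}
    (hw : w ⬝ᵥ ψ = 0) : w ⬝ᵥ A ^ m *ᵥ w ≤ μ ^ m * (w ⬝ᵥ w) := by
  induction m with
  | zero => simp
  | succ k ih =>
    calc w ⬝ᵥ A ^ (k + 1) *ᵥ w ≤ μ * (w ⬝ᵥ A ^ k *ᵥ w) :=
          hA.dotProduct_pow_succ_mulVec_le hψ hμ hperp k hw
      _ ≤ μ * (μ ^ k * (w ⬝ᵥ w)) := by gcongr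
      _ = μ ^ (k + 1) * (w ⬝ᵥ w) := by ring

theorem Matrix.pow_mulVec_of_mulVec_eq_smul {A : Matrix ι ι ℝ} {ψ : ι → ℝ} {lam : ℝ}
    (hψ : A *ᵥ ψ = lam • ψ) (m : ℕ) : A ^ m *ᵥ ψ = lam ^ m • ψ := by
  induction m with
  | zero => simp
  | succ k ih => rw [pow_succ, ← mulVec_mulVec, hψ, mulVec_smul, ih, smul_smul, pow_succ']

/-- The `m`-th moment of `c ψ + w`, for a unit eigenvector `ψ` of `A` orthogonal to `w`. -/
theorem Matrix.IsSymm.dotProduct_pow_mulVec_smul_add {A : Matrix ι ι ℝ} (hA : A.IsSymm)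
    {ψ w : ι → ℝ} {lam : ℝ} (hψ : A *ᵥ ψ = lam • ψ) (hunit : ψ ⬝ᵥ ψ = 1) (hw : w ⬝ᵥ ψ = 0)
    (c : ℝ) (m : ℕ) :
    (c • ψ + w) ⬝ᵥ A ^ m *ᵥ (c • ψ + w) = c ^ 2 * lam ^ m + w ⬝ᵥ A ^ m *ᵥ w := by
  have hpow := pow_mulVec_of_mulVec_eq_smul hψ m
  have hcross : ψ ⬝ᵥ A ^ m *ᵥ w = 0 := by
    rw [← (hA.pow m).mulVec_dotProduct, hpow, smul_dotProduct, dotProduct_comm, hw, smul_zero]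
  simp only [mulVec_add, mulVec_smul, add_dotProduct, dotProduct_add, smul_dotProduct,
    dotProduct_smul, hpow, hunit, hw, hcross, smul_eq_mul]
  ring

end SpectralGap

/-- Lemma 6.2 of the paper. Let `G` be a real symmetric nonnegative
`2^n × 2^n` matrix with largest eigenvalue `μ₀ ∈ (0,1]`, nonnegative unit top eigenvector
`Ψ₀`, all eigenvalues in `[0, μ₀]`, and all eigenvalues on the orthogonal complement of
`Ψ₀` at most `μ₁`, where `(μ₁/μ₀)^L ≤ 2^{−5n/2}`. Then `Σ_{x,y}(G^L)_{xy} > 0` and the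
ratio `Σ_{x,y}(G^{L+1})_{xy} / Σ_{x,y}(G^L)_{xy}` is within `4·2^{−3n/2}` of `μ₀`. -/
theorem gap_lemma_ratio_approximates_top_eigenvalue (n : ℕ) (hn : 1 ≤ n)
    (G : Matrix (Fin (2 ^ n)) (Fin (2 ^ n)) ℝ) (hsymm : G.IsSymm)
    (hnn : ∀ x y, 0 ≤ G x y)
    (μ₀ : ℝ) (hμ₀pos : 0 < μ₀) (hμ₀le : μ₀ ≤ 1)
    (Ψ₀ : Fin (2 ^ n) → ℝ) (hΨnn : ∀ x, 0 ≤ Ψ₀ x) (hunit : ∑ x, Ψ₀ x ^ 2 = 1)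
    (heig : G.mulVec Ψ₀ = μ₀ • Ψ₀)
    (hspec : ∀ (μ : ℝ) (v : Fin (2 ^ n) → ℝ), v ≠ 0 → G.mulVec v = μ • v →
      0 ≤ μ ∧ μ ≤ μ₀)
    (μ₁ : ℝ) (hμ₁0 : 0 ≤ μ₁)
    (hperp : ∀ w : Fin (2 ^ n) → ℝ, w ⬝ᵥ Ψ₀ = 0 →
      w ⬝ᵥ G.mulVec w ≤ μ₁ * (w ⬝ᵥ w))
    (L : ℕ) (hL : 1 ≤ L)
    (hgap : (μ₁ / μ₀) ^ L ≤ (2 : ℝ) ^ (-(5 * (n : ℝ)) / 2 : ℝ)) :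
    0 < ∑ x, ∑ y, (G ^ L) x y ∧
      |(∑ x, ∑ y, (G ^ (L + 1)) x y) / (∑ x, ∑ y, (G ^ L) x y) - μ₀| ≤
        4 * (2 : ℝ) ^ (-(3 * (n : ℝ)) / 2 : ℝ) := by
  have hG : G.PosSemidef :=
    hsymm.posSemidef_of_eigenvalue_nonneg fun μ v hv h => (hspec μ v hv h).1
  have hΨ : Ψ₀ ⬝ᵥ Ψ₀ = 1 := by simpa [dotProduct, sq] using hunit
  set c : ℝ := ∑ x, Ψ₀ x
  have hc1 : 1 ≤ c := one_le_sum_of_sum_sq_eq_one hΨnn hunit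
  obtain ⟨w, hw⟩ : ∃ w : Fin (2 ^ n) → ℝ, c • Ψ₀ + w = 1 := ⟨1 - c • Ψ₀, by simp⟩
  have hwΨ : w ⬝ᵥ Ψ₀ = 0 := by
    have h : (c • Ψ₀ + w) ⬝ᵥ Ψ₀ = c := by rw [hw, one_dotProduct]
    simpa [add_dotProduct, hΨ] using h
  have hsum (m : ℕ) :
      ∑ x, ∑ y, (G ^ m) x y = c ^ 2 * μ₀ ^ m + w ⬝ᵥ G ^ m *ᵥ w := by
    rw [← hsymm.dotProduct_pow_mulVec_smul_add heig hΨ hwΨ, hw]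
    simp [dotProduct, mulVec]
  have hnonneg (m : ℕ) : 0 ≤ w ⬝ᵥ G ^ m *ᵥ w := by
    simpa using (hG.pow m).dotProduct_mulVec_nonneg w
  have hww : w ⬝ᵥ w ≤ 2 ^ n := by
    have h := hsum 0
    simp only [pow_zero, one_mulVec, mul_one] at h
    have h1 : ∑ x, ∑ y, (1 : Matrix (Fin (2 ^ n)) (Fin (2 ^ n)) ℝ) x y = 2 ^ n := by
      simp [Matrix.one_apply]
    nlinarith
  have hgap_lt : (μ₁ / μ₀) ^ L < 1 := by
    refine hgap.trans_lt (Real.rpow_lt_one_of_one_lt_of_neg one_lt_two ?_)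
    have : (1 : ℝ) ≤ n := by exact_mod_cast hn
    linarith
  have hμ : μ₁ ≤ μ₀ := by
    by_contra! h
    exact hgap_lt.not_ge (one_le_pow₀ ((one_le_div hμ₀pos).2 h.le))
  have hstep := hG.dotProduct_pow_succ_mulVec_le heig hμ₁0 hperp L hwΨ
  have hmoment := hG.dotProduct_pow_mulVec_le heig hμ₁0 hperp L hwΨ
  have hpow : 0 < μ₀ ^ L := pow_pos hμ₀pos L
  have hlow : μ₀ ^ L ≤ ∑ x, ∑ y, (G ^ L) x y := by
    rw [hsum]
    linarith [hnonneg L, le_mul_of_one_le_left hpow.le (one_le_pow₀ hc1 : 1 ≤ c ^ 2)]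
  have hpos : 0 < ∑ x, ∑ y, (G ^ L) x y := hpow.trans_le hlow
  refine ⟨hpos, ?_⟩
  have hdiff : |(∑ x, ∑ y, (G ^ (L + 1)) x y) - μ₀ * ∑ x, ∑ y, (G ^ L) x y| ≤
      w ⬝ᵥ G ^ L *ᵥ w := by
    have h : (∑ x, ∑ y, (G ^ (L + 1)) x y) - μ₀ * ∑ x, ∑ y, (G ^ L) x y =
        w ⬝ᵥ G ^ (L + 1) *ᵥ w - μ₀ * (w ⬝ᵥ G ^ L *ᵥ w) := by
      rw [hsum, hsum]
      ring
    rw [h, abs_le]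
    constructor <;> nlinarith [hnonneg L, hnonneg (L + 1)]
  have hexp : (2 : ℝ) ^ (-(5 * (n : ℝ)) / 2 : ℝ) * 2 ^ n = 2 ^ (-(3 * (n : ℝ)) / 2 : ℝ) := by
    rw [← Real.rpow_natCast, ← Real.rpow_add two_pos]
    congr 1
    ring
  calc |(∑ x, ∑ y, (G ^ (L + 1)) x y) / (∑ x, ∑ y, (G ^ L) x y) - μ₀|
      = |(∑ x, ∑ y, (G ^ (L + 1)) x y) - μ₀ * ∑ x, ∑ y, (G ^ L) x y| /
          ∑ x, ∑ y, (G ^ L) x y := by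
        rw [div_sub' hpos.ne', abs_div, abs_of_pos hpos, mul_comm μ₀]
    _ ≤ (μ₁ ^ L * 2 ^ n) / μ₀ ^ L := by
        gcongr
        exact hdiff.trans (hmoment.trans (by gcongr))
    _ = (μ₁ / μ₀) ^ L * 2 ^ n := by rw [div_pow]; ring
    _ ≤ 2 ^ (-(3 * (n : ℝ)) / 2 : ℝ) := by
        rw [← hexp]
        gcongr
    _ ≤ 4 * 2 ^ (-(3 * (n : ℝ)) / 2 : ℝ) := by
        linarith [Real.rpow_pos_of_pos two_pos (-(3 * (n : ℝ)) / 2 : ℝ)]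
end
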